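/- Let {f_n} be a sequence of nonnegative measurable functions on a probability space (Ω, F, P). Then there exist a strictly increasing sequence of indices n_1 < n_2 < ⋯, measurable functions f^{(k)} : Ω → [0, ∞) (k ∈ ℕ) such that for every k the truncations f_{n_j}^{(k)} := f_{n_j} · 1_{{k−1 ≤ f_{n_j} < k}} converge hereditarily in Cesàro mean to f^{(k)} P-a.e., and a measurable set A ⊇ A_∞ := {f = ∞}, where f := Σ_{k∈ℕ} f^{(k)}, such that the subsequence {f_{n_j}} converges hereditarily in Cesàro mean, P-a.e., to the function f* which equals ∞ on A and equals f on Ω \ A. -/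

import Mathlib

open MeasureTheory Filter Finset
open scoped ENNReal

/-- The truncation `f^(k) = f · 1_{k-1 ≤ f < k}` of a function `f`. -/
noncomputable def trunc {Ω : Type*} (g : Ω → ℝ) (k : ℕ) : Ω → ℝ :=
  ({ω | (k : ℝ) - 1 ≤ g ω ∧ g ω < k}).indicator g

/-- `W` is the weak limit of the sequence `g`, tested against bounded measurable functions, along
the canonical nonprincipal ultrafilter on `ℕ`. -/
def IsUltraWeakLimit {Ω : Type*} [MeasurableSpace Ω] (P : Measure Ω) (g : ℕ → Ω → ℝ)
    (W : Ω → ℝ) : Prop :=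
  ∀ h : Ω → ℝ, Measurable h → (∃ c, ∀ ω, |h ω| ≤ c) →
    Tendsto (fun n => ∫ ω, h ω * g n ω ∂P) (hyperfilter ℕ) (nhds (∫ ω, h ω * W ω ∂P))

lemma exists_isUltraWeakLimit {Ω : Type*} [MeasurableSpace Ω] (P : Measure Ω)
    [IsFiniteMeasure P] (g : ℕ → Ω → ℝ) (hg : ∀ n, Measurable (g n)) {b : ℝ}
    (h0 : ∀ n ω, 0 ≤ g n ω) (hb : ∀ n ω, g n ω ≤ b) (hb0 : 0 ≤ b) :
    ∃ W : Ω → ℝ, Measurable W ∧ (∀ ω, 0 ≤ W ω) ∧ (∀ ω, W ω ≤ b) ∧ IsUltraWeakLimit P g W := by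
  have hmem : ∀ n, MemLp (g n) 2 P := fun n =>
    MemLp.of_bound (hg n).aestronglyMeasurable b
      (ae_of_all _ fun ω => by rw [Real.norm_eq_abs, abs_of_nonneg (h0 n ω)]; exact hb n ω)
  set x : ℕ → Lp ℝ 2 P := fun n => (hmem n).toLp with hx
  obtain ⟨R, hR⟩ : ∃ R : ℝ, ∀ n, ‖x n‖ ≤ R := by
    refine ⟨_, fun n => Lp.norm_le_of_ae_bound hb0 ?_⟩
    filter_upwards [(hmem n).coeFn_toLp] with ω hω
    rw [hω, Real.norm_eq_abs, abs_of_nonneg (h0 n ω)]; exact hb n ω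
  let L : ℕ → WeakDual ℝ (Lp ℝ 2 P) := fun n =>
    StrongDual.toWeakDual (InnerProductSpace.toDual ℝ (Lp ℝ 2 P) (x n))
  have hcpt := WeakDual.isCompact_closedBall (𝕜 := ℝ) (0 : StrongDual ℝ (Lp ℝ 2 P)) R
  obtain ⟨y, -, hy⟩ := hcpt.ultrafilter_le_nhds ((hyperfilter ℕ).map L) (by
    rw [Ultrafilter.coe_map, le_principal_iff, Filter.mem_map]
    refine univ_mem' fun n => ?_
    simp only [Set.mem_preimage, mem_closedBall_zero_iff, L]
    change ‖InnerProductSpace.toDual ℝ (Lp ℝ 2 P) (x n)‖ ≤ R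
    rw [LinearIsometryEquiv.norm_map]; exact hR n)
  set Y : Lp ℝ 2 P := (InnerProductSpace.toDual ℝ (Lp ℝ 2 P)).symm (WeakDual.toStrongDual y)
    with hY
  have hlim : ∀ h : Ω → ℝ, Measurable h → (∃ c, ∀ ω, |h ω| ≤ c) →
      Tendsto (fun n => ∫ ω, h ω * g n ω ∂P) (hyperfilter ℕ) (nhds (∫ ω, h ω * Y ω ∂P)) := by
    rintro h hm ⟨c, hc⟩
    have hh : MemLp h 2 P := MemLp.of_bound hm.aestronglyMeasurable c (ae_of_all _ hc)
    have ht : Tendsto (fun n => L n hh.toLp) (hyperfilter ℕ) (nhds (y hh.toLp)) :=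
      tendsto_iff_forall_eval_tendsto_topDualPairing.1 (show Tendsto L _ (nhds y) from hy) _
    have e1 : ∀ n, L n hh.toLp = ∫ ω, h ω * g n ω ∂P := by
      intro n
      change inner ℝ (x n) hh.toLp = _
      rw [L2.inner_def]
      refine integral_congr_ae ?_
      filter_upwards [(hmem n).coeFn_toLp, hh.coeFn_toLp] with ω h1 h2
      rw [h1, h2]; simp
    have e2 : y hh.toLp = ∫ ω, h ω * Y ω ∂P := by
      have : y hh.toLp = inner ℝ Y hh.toLp := by
        rw [hY, InnerProductSpace.toDual_symm_apply]; rfl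
      rw [this, L2.inner_def]
      refine integral_congr_ae ?_
      filter_upwards [hh.coeFn_toLp] with ω h2
      rw [h2]; simp
    simpa only [e1, e2] using ht
  have hYi : Integrable Y P := (Lp.memLp Y).integrable (by norm_num)
  have hgi : ∀ n, Integrable (g n) P := fun n => (hmem n).integrable (by norm_num)
  have hset : ∀ s, MeasurableSet s →
      Tendsto (fun n => ∫ ω in s, g n ω ∂P) (hyperfilter ℕ) (nhds (∫ ω in s, Y ω ∂P)) := by
    intro s hs
    have := hlim (s.indicator 1) (measurable_one.indicator hs) ⟨1, fun ω => by
      by_cases h : ω ∈ s <;> simp [h]⟩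
    have e : ∀ k : Ω → ℝ, ∫ ω, s.indicator 1 ω * k ω ∂P = ∫ ω in s, k ω ∂P := by
      intro k
      rw [← integral_indicator hs]
      congr 1; ext ω; by_cases h : ω ∈ s <;> simp [h]
    simpa only [e] using this
  have hY0 : 0 ≤ᵐ[P] Y := by
    refine ae_nonneg_of_forall_setIntegral_nonneg hYi fun s hs _ => ?_
    exact ge_of_tendsto' (hset s hs) fun n => setIntegral_nonneg hs fun ω _ => h0 n ω
  have hYb : Y ≤ᵐ[P] fun _ => b := by
    refine ae_le_of_forall_setIntegral_le hYi (integrable_const b) fun s hs _ => ?_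
    exact le_of_tendsto' (hset s hs) fun n =>
      setIntegral_mono (hgi n).integrableOn (integrable_const b).integrableOn fun ω => hb n ω
  refine ⟨fun ω => max 0 (min b (Y ω)), ?_, fun ω => le_max_left _ _,
    fun ω => max_le hb0 (min_le_left _ _), fun h hm hc => ?_⟩
  · exact measurable_const.max (measurable_const.min (Lp.stronglyMeasurable Y).measurable)
  · have : ∫ ω, h ω * max 0 (min b (Y ω)) ∂P = ∫ ω, h ω * Y ω ∂P := by
      refine integral_congr_ae ?_
      filter_upwards [hY0, hYb] with ω h1 h2
      simp only [Pi.zero_apply] at h1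
      rw [min_eq_right h2, max_eq_right h1]
    rw [this]; exact hlim h hm hc

lemma exists_strictMono_of_eventually_hyperfilter {Q : ℕ → ℕ → ℕ → Prop}
    (hQ : ∀ m N, ∀ᶠ n in (hyperfilter ℕ : Filter ℕ), Q m N n) :
    ∃ n : ℕ → ℕ, StrictMono n ∧ ∀ p m, p < m → Q m (n p) (n m) := by
  obtain ⟨s, -, hs⟩ := exists_seq_of_forall_finset_exists (α := ℕ × ℕ) (fun _ => True)
    (fun x y => x.1 < y.1 ∧ x.2 < y.2 ∧ ∀ m ≤ y.1, Q m x.2 y.2) (fun t _ => by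
      have h1 : ∀ᶠ m in (atTop : Filter ℕ), ∀ x ∈ t, x.1 < m :=
        (Filter.eventually_all_finset t).2 fun x _ => eventually_gt_atTop x.1
      obtain ⟨m, hm⟩ := h1.exists
      have h2 : ∀ᶠ n in (hyperfilter ℕ : Filter ℕ), ∀ x ∈ t, x.2 < n ∧
          ∀ m' ∈ Finset.Iic m, Q m' x.2 n :=
        (Filter.eventually_all_finset t).2 fun x _ =>
          ((eventually_gt_atTop x.2).filter_mono Nat.hyperfilter_le_atTop).and
            ((Filter.eventually_all_finset _).2 fun m' _ => hQ m' x.2)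
      obtain ⟨n, hn⟩ := h2.exists
      exact ⟨(m, n), trivial, fun x hx => ⟨hm x hx, (hn x hx).1, fun m' hm' =>
        (hn x hx).2 m' (Finset.mem_Iic.2 hm')⟩⟩)
  have hfst : StrictMono fun j => (s j).1 := fun i j hij => (hs i j hij).1
  exact ⟨fun j => (s j).2, fun i j hij => (hs i j hij).2.1, fun p m hpm =>
    (hs p m hpm).2.2 m (hfst.le_apply)⟩

lemma summable_sum_range_floor_pow_div_sq {b : ℕ → ℝ} (hb : ∀ j, 0 ≤ b j)
    (hs : Summable fun j : ℕ => b j / ((j : ℝ) + 1) ^ 2) {c : ℝ} (hc : 1 < c) :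
    Summable fun n : ℕ => (∑ j ∈ range ⌊c ^ n⌋₊, b j) / (⌊c ^ n⌋₊ : ℝ) ^ 2 := by
  set D : ℝ := c ^ 5 * (c - 1)⁻¹ ^ 3 with hD
  have hD0 : 0 ≤ D := by
    have : 0 < c - 1 := by linarith
    positivity
  refine summable_of_sum_range_le (c := 4 * D * ∑' j : ℕ, b j / ((j : ℝ) + 1) ^ 2)
    (fun n => div_nonneg (sum_nonneg fun j _ => hb j) (sq_nonneg _)) fun N => ?_
  obtain ⟨L, hL⟩ : ∃ L, ∀ n ∈ range N, ⌊c ^ n⌋₊ ≤ L :=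
    ⟨_, fun n hn => Finset.single_le_sum (f := fun n => ⌊c ^ n⌋₊) (fun _ _ => Nat.zero_le _) hn⟩
  calc ∑ n ∈ range N, (∑ j ∈ range ⌊c ^ n⌋₊, b j) / (⌊c ^ n⌋₊ : ℝ) ^ 2
      = ∑ n ∈ range N, ∑ j ∈ range L,
          if (j : ℝ) + 1 / 2 < ⌊c ^ n⌋₊ then b j * (1 / (⌊c ^ n⌋₊ : ℝ) ^ 2) else 0 := by
        refine sum_congr rfl fun n hn => ?_
        rw [sum_div, ← sum_filter]
        refine sum_congr ?_ fun j _ => by ring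
        ext j
        have : (j : ℝ) + 1 / 2 < ⌊c ^ n⌋₊ ↔ j < ⌊c ^ n⌋₊ := by
          constructor
          · intro h
            have : (j : ℝ) < ⌊c ^ n⌋₊ := by linarith
            exact_mod_cast this
          · intro h
            have : (j : ℝ) + 1 ≤ ⌊c ^ n⌋₊ := by exact_mod_cast h
            linarith
        simp only [mem_range, mem_filter, this]
        exact ⟨fun h => ⟨h.trans_le (hL n hn), h⟩, fun h => h.2⟩
    _ = ∑ j ∈ range L, b j *
          ∑ n ∈ range N with (j : ℝ) + 1 / 2 < ⌊c ^ n⌋₊, 1 / (⌊c ^ n⌋₊ : ℝ) ^ 2 := by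
        rw [sum_comm]
        refine sum_congr rfl fun j _ => ?_
        rw [mul_sum, sum_filter]
    _ ≤ ∑ j ∈ range L, 4 * D * (b j / ((j : ℝ) + 1) ^ 2) := by
        refine sum_le_sum fun j _ => ?_
        have h1 := sum_div_nat_floor_pow_sq_le_div_sq N
          (show (0 : ℝ) < (j : ℝ) + 1 / 2 by positivity) hc
        have h2 : D / ((j : ℝ) + 1 / 2) ^ 2 ≤ 4 * D / ((j : ℝ) + 1) ^ 2 := by
          rw [div_le_div_iff₀ (by positivity) (by positivity)]
          have : ((j : ℝ) + 1) ^ 2 ≤ 4 * ((j : ℝ) + 1 / 2) ^ 2 := by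
            nlinarith [Nat.cast_nonneg (α := ℝ) j]
          nlinarith
        calc _ ≤ b j * (4 * D / ((j : ℝ) + 1) ^ 2) :=
              mul_le_mul_of_nonneg_left (h1.trans h2) (hb j)
          _ = _ := by ring
    _ ≤ _ := by
        rw [← mul_sum]
        refine mul_le_mul_of_nonneg_left ?_ (by positivity)
        exact hs.sum_le_tsum _ fun j _ => div_nonneg (hb j) (sq_nonneg _)

lemma integral_sum_range_sq_le {Ω : Type*} [MeasurableSpace Ω] {μ : Measure Ω}
    {x : ℕ → Ω → ℝ} (hx : ∀ j, MemLp (x j) 2 μ) (K : ℕ) :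
    ∫ ω, (∑ j ∈ range K, x j ω) ^ 2 ∂μ ≤
      ∑ j ∈ range K, (∫ ω, x j ω ^ 2 ∂μ + 2 * ∑ i ∈ range j, |∫ ω, x i ω * x j ω ∂μ|) := by
  have hmul : ∀ i j, Integrable (fun ω => x i ω * x j ω) μ := fun i j =>
    (hx i).integrable_mul (hx j)
  induction K with
  | zero => simp
  | succ K ih =>
    have hS : MemLp (fun ω => ∑ j ∈ range K, x j ω) 2 μ := memLp_finsetSum _ fun j _ => hx j
    have hcr : Integrable (fun ω => x K ω ^ 2 + 2 * ∑ i ∈ range K, x i ω * x K ω) μ :=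
      (hx K).integrable_sq.add ((integrable_finsetSum _ fun i _ => hmul i K).const_mul 2)
    have e : ∫ ω, (∑ j ∈ range (K + 1), x j ω) ^ 2 ∂μ =
        ∫ ω, (∑ j ∈ range K, x j ω) ^ 2 ∂μ + (∫ ω, x K ω ^ 2 ∂μ +
          2 * ∑ i ∈ range K, ∫ ω, x i ω * x K ω ∂μ) := by
      rw [← integral_finsetSum _ fun i _ => hmul i K, ← integral_const_mul,
        ← integral_add (hx K).integrable_sq
          ((integrable_finsetSum _ fun i _ => hmul i K).const_mul 2),
        ← integral_add hS.integrable_sq hcr]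
      congr 1; ext ω
      rw [sum_range_succ, ← sum_mul]; ring
    rw [e, sum_range_succ]
    have : ∑ i ∈ range K, ∫ ω, x i ω * x K ω ∂μ ≤ ∑ i ∈ range K, |∫ ω, x i ω * x K ω ∂μ| :=
      sum_le_sum fun i _ => le_abs_self _
    linarith

lemma ae_tendsto_zero_of_summable_integral_sq {Ω : Type*} [MeasurableSpace Ω] {μ : Measure Ω}
    {y : ℕ → Ω → ℝ} (hy : ∀ n, MemLp (y n) 2 μ)
    (hs : Summable fun n => ∫ ω, y n ω ^ 2 ∂μ) :
    ∀ᵐ ω ∂μ, Tendsto (fun n => y n ω) atTop (nhds 0) := by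
  have h1 : ∫⁻ ω, ∑' n, ENNReal.ofReal (y n ω ^ 2) ∂μ ≠ ⊤ := by
    rw [lintegral_tsum fun n => (hy n).integrable_sq.aemeasurable.ennreal_ofReal]
    have : ∀ n, ∫⁻ ω, ENNReal.ofReal (y n ω ^ 2) ∂μ = ENNReal.ofReal (∫ ω, y n ω ^ 2 ∂μ) :=
      fun n => (ofReal_integral_eq_lintegral_ofReal (hy n).integrable_sq
        (ae_of_all _ fun ω => sq_nonneg _)).symm
    simp_rw [this]
    exact hs.tsum_ofReal_ne_top
  have h2 : AEMeasurable (fun ω => ∑' n, ENNReal.ofReal (y n ω ^ 2)) μ :=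
    AEMeasurable.tsum fun n => (hy n).integrable_sq.aemeasurable.ennreal_ofReal
  filter_upwards [ae_lt_top' h2 h1] with ω hω
  have h3 := ENNReal.tendsto_atTop_zero_of_tsum_ne_top hω.ne
  have h4 : Tendsto (fun n => y n ω ^ 2) atTop (nhds 0) := by
    have := (ENNReal.tendsto_toReal ENNReal.zero_ne_top).comp h3
    simpa [Function.comp_def, ENNReal.toReal_ofReal, sq_nonneg] using this
  have h5 := (Real.continuous_sqrt.tendsto 0).comp h4
  rw [Real.sqrt_zero] at h5
  refine (tendsto_zero_iff_abs_tendsto_zero _).2 ?_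
  simpa [Function.comp_def, Real.sqrt_sq_eq_abs] using h5

lemma tendsto_sum_range_div {u : ℕ → ℝ} {l : ℝ} (h : Tendsto u atTop (nhds l)) :
    Tendsto (fun K : ℕ => (∑ j ∈ range K, u j) / K) atTop (nhds l) :=
  h.cesaro.congr fun K => by rw [div_eq_inv_mul]

lemma summable_one_div_succ_sq : Summable fun j : ℕ => 1 / ((j : ℝ) + 1) ^ 2 := by
  have := (summable_nat_add_iff 1).2 (Real.summable_one_div_nat_pow.2 (by norm_num : 1 < 2))
  exact_mod_cast this

/-- A strong law of large numbers for nonnegative, nearly orthogonal (after centring) sequences,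
following Etemadi's argument. -/
lemma ae_tendsto_cesaro_of_almost_orthogonal {Ω : Type*} [MeasurableSpace Ω] {μ : Measure Ω}
    [IsFiniteMeasure μ] {u v : ℕ → Ω → ℝ} {w : Ω → ℝ} {M : ℝ}
    (hu : ∀ j, Measurable (u j)) (hu0 : ∀ j ω, 0 ≤ u j ω) (hub : ∀ j, ∃ c, ∀ ω, u j ω ≤ c)
    (hv : ∀ j, Measurable (v j)) (hvM : ∀ j, ∀ᵐ ω ∂μ, |v j ω| ≤ M)
    (hvw : ∀ᵐ ω ∂μ, Tendsto (fun j => v j ω) atTop (nhds (w ω)))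
    (hsq : Summable fun j : ℕ => (∫ ω, u j ω ^ 2 ∂μ) / ((j : ℝ) + 1) ^ 2)
    (hcross : ∀ᶠ j : ℕ in atTop, ∀ i < j,
      |∫ ω, (u i ω - v i ω) * (u j ω - v j ω) ∂μ| ≤ 1 / ((j : ℝ) + 1) ^ 2) :
    ∀ᵐ ω ∂μ, Tendsto (fun K : ℕ => (∑ j ∈ range K, u j ω) / K) atTop (nhds (w ω)) := by
  set x : ℕ → Ω → ℝ := fun j ω => u j ω - v j ω with hx
  have hum : ∀ j, MemLp (u j) 2 μ := fun j => by
    obtain ⟨c, hc⟩ := hub j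
    exact MemLp.of_bound (hu j).aestronglyMeasurable c
      (ae_of_all _ fun ω => by rw [Real.norm_eq_abs, abs_of_nonneg (hu0 j ω)]; exact hc ω)
  have hvm : ∀ j, MemLp (v j) 2 μ := fun j =>
    MemLp.of_bound (hv j).aestronglyMeasurable M (hvM j)
  have hxm : ∀ j, MemLp (x j) 2 μ := fun j => (hum j).sub (hvm j)
  set b : ℕ → ℝ := fun j =>
    ∫ ω, x j ω ^ 2 ∂μ + 2 * ∑ i ∈ range j, |∫ ω, x i ω * x j ω ∂μ| with hb
  have hb0 : ∀ j, 0 ≤ b j := fun j =>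
    add_nonneg (integral_nonneg fun ω => sq_nonneg _)
      (mul_nonneg zero_le_two (sum_nonneg fun i _ => abs_nonneg _))
  have hxsq : ∀ j, ∫ ω, x j ω ^ 2 ∂μ ≤ 2 * ∫ ω, u j ω ^ 2 ∂μ + 2 * M ^ 2 * μ.real Set.univ := by
    intro j
    have e : 2 * ∫ ω, u j ω ^ 2 ∂μ + 2 * M ^ 2 * μ.real Set.univ =
        ∫ ω, (2 * u j ω ^ 2 + 2 * M ^ 2) ∂μ := by
      rw [integral_add ((hum j).integrable_sq.const_mul 2) (integrable_const _),
        integral_const_mul, integral_const, smul_eq_mul]; ring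
    rw [e]
    refine integral_mono_ae (hxm j).integrable_sq
      (((hum j).integrable_sq.const_mul 2).add (integrable_const _)) ?_
    filter_upwards [hvM j] with ω hω
    have : v j ω ^ 2 ≤ M ^ 2 := by rw [← sq_abs]; gcongr
    simp only [hx]
    nlinarith [sq_nonneg (u j ω + v j ω)]
  have hbs : Summable fun j : ℕ => b j / ((j : ℝ) + 1) ^ 2 := by
    refine Summable.of_norm_bounded_eventually_nat
      ((hsq.mul_left 2).add
        (summable_one_div_succ_sq.mul_left (2 * M ^ 2 * μ.real Set.univ + 2))) ?_
    filter_upwards [hcross] with j hj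
    rw [Real.norm_eq_abs, abs_of_nonneg (div_nonneg (hb0 j) (sq_nonneg _))]
    have h1 : ∑ i ∈ range j, |∫ ω, x i ω * x j ω ∂μ| ≤ 1 := by
      calc _ ≤ ∑ i ∈ range j, 1 / ((j : ℝ) + 1) ^ 2 :=
            sum_le_sum fun i hi => hj i (mem_range.1 hi)
        _ = j / ((j : ℝ) + 1) ^ 2 := by simp [div_eq_mul_inv]
        _ ≤ 1 := by
          rw [div_le_one (by positivity)]; nlinarith [Nat.cast_nonneg (α := ℝ) j]
    have h2 : b j ≤ 2 * ∫ ω, u j ω ^ 2 ∂μ + (2 * M ^ 2 * μ.real Set.univ + 2) := by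
      have := hxsq j
      simp only [hb]; linarith
    calc b j / ((j : ℝ) + 1) ^ 2
        ≤ (2 * ∫ ω, u j ω ^ 2 ∂μ + (2 * M ^ 2 * μ.real Set.univ + 2)) / ((j : ℝ) + 1) ^ 2 := by
          gcongr
      _ = _ := by ring
  have hgeo : ∀ k : ℕ, ∀ᵐ ω ∂μ, Tendsto (fun n : ℕ =>
      (∑ j ∈ range ⌊(1 + 1 / ((k : ℝ) + 1)) ^ n⌋₊, x j ω) / ⌊(1 + 1 / ((k : ℝ) + 1)) ^ n⌋₊)
      atTop (nhds 0) := by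
    intro k
    have hc : 1 < 1 + 1 / ((k : ℝ) + 1) := by
      have : 0 < 1 / ((k : ℝ) + 1) := by positivity
      linarith
    refine ae_tendsto_zero_of_summable_integral_sq (fun n => ?_) ?_
    · have : MemLp (fun ω => ∑ j ∈ range ⌊(1 + 1 / ((k : ℝ) + 1)) ^ n⌋₊, x j ω) 2 μ :=
        memLp_finsetSum _ fun j _ => hxm j
      simpa only [div_eq_inv_mul] using this.const_mul _
    · refine Summable.of_nonneg_of_le (fun n => integral_nonneg fun ω => sq_nonneg _)
        (fun n => ?_) (summable_sum_range_floor_pow_div_sq hb0 hbs hc)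
      simp_rw [div_pow]
      rw [integral_div]
      exact div_le_div_of_nonneg_right (integral_sum_range_sq_le hxm _) (sq_nonneg _)
  filter_upwards [ae_all_iff.2 hgeo, hvw] with ω hω hvω
  refine tendsto_div_of_monotone_of_tendsto_div_floor_pow (fun K => ∑ j ∈ range K, u j ω) (w ω)
    (monotone_nat_of_le_succ fun K => by
      simp only [sum_range_succ]; exact le_add_of_nonneg_right (hu0 K ω))
    (fun k => 1 + 1 / ((k : ℝ) + 1)) (fun k => ?_) ?_ fun k => ?_
  · have : 0 < 1 / ((k : ℝ) + 1) := by positivity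
    linarith
  · simpa using tendsto_one_div_add_atTop_nhds_zero_nat (𝕜 := ℝ) |>.const_add 1
  · have hc : 1 < 1 + 1 / ((k : ℝ) + 1) := by
      have : 0 < 1 / ((k : ℝ) + 1) := by positivity
      linarith
    have h1 : Tendsto (fun n : ℕ => ⌊(1 + 1 / ((k : ℝ) + 1)) ^ n⌋₊) atTop atTop :=
      tendsto_nat_floor_atTop.comp (tendsto_pow_atTop_atTop_of_one_lt hc)
    have h2 := (hω k).add ((tendsto_sum_range_div hvω).comp h1)
    rw [zero_add] at h2
    refine h2.congr fun n => ?_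
    simp only [Function.comp_apply, hx]
    rw [← add_div, ← sum_add_distrib]
    simp

/-- The function `g · 1_{g < a}`. -/
noncomputable def cutoff {Ω : Type*} (a : ℕ) (g : Ω → ℝ) : Ω → ℝ :=
  ({ω | g ω < a}).indicator g

/-- The indicator function of `{l ≤ g}`. -/
noncomputable def tailIndicator {Ω : Type*} (l : ℕ) (g : Ω → ℝ) : Ω → ℝ :=
  ({ω | (l : ℝ) ≤ g ω}).indicator 1

section Pointwise

variable {Ω : Type*} {g : Ω → ℝ} {ω : Ω}

lemma cutoff_apply (a : ℕ) (g : Ω → ℝ) (ω : Ω) :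
    cutoff a g ω = if g ω < a then g ω else 0 := by
  simp [cutoff, Set.indicator_apply]

lemma tailIndicator_apply (l : ℕ) (g : Ω → ℝ) (ω : Ω) :
    tailIndicator l g ω = if (l : ℝ) ≤ g ω then 1 else 0 := by
  simp [tailIndicator, Set.indicator_apply]

lemma trunc_apply (g : Ω → ℝ) (k : ℕ) (ω : Ω) :
    trunc g k ω = if (k : ℝ) - 1 ≤ g ω ∧ g ω < k then g ω else 0 := by
  simp [trunc, Set.indicator_apply]

lemma tailIndicator_nonneg (l : ℕ) (g : Ω → ℝ) (ω : Ω) : 0 ≤ tailIndicator l g ω := by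
  rw [tailIndicator_apply]; split_ifs <;> norm_num

lemma tailIndicator_le_one (l : ℕ) (g : Ω → ℝ) (ω : Ω) : tailIndicator l g ω ≤ 1 := by
  rw [tailIndicator_apply]; split_ifs <;> norm_num

lemma tailIndicator_anti {l k : ℕ} (h : l ≤ k) (g : Ω → ℝ) (ω : Ω) :
    tailIndicator k g ω ≤ tailIndicator l g ω := by
  have : (l : ℝ) ≤ k := by exact_mod_cast h
  rw [tailIndicator_apply, tailIndicator_apply]
  split_ifs <;> linarith

lemma trunc_nonneg (hg : 0 ≤ g ω) (k : ℕ) : 0 ≤ trunc g k ω := by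
  rw [trunc_apply]; split_ifs <;> simp [hg]

lemma trunc_le (k : ℕ) : trunc g k ω ≤ k := by
  rw [trunc_apply]; split_ifs with h
  · exact h.2.le
  · positivity

lemma cutoff_nonneg (hg : 0 ≤ g ω) (a : ℕ) : 0 ≤ cutoff a g ω := by
  rw [cutoff_apply]; split_ifs <;> simp [hg]

lemma cutoff_le (a : ℕ) : cutoff a g ω ≤ a := by
  rw [cutoff_apply]; split_ifs with h
  · exact h.le
  · positivity

lemma cutoff_le_self (hg : 0 ≤ g ω) (a : ℕ) : cutoff a g ω ≤ g ω := by
  rw [cutoff_apply]; split_ifs <;> simp [hg]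

lemma mul_tailIndicator_le_self (hg : 0 ≤ g ω) (l : ℕ) : l * tailIndicator l g ω ≤ g ω := by
  rw [tailIndicator_apply]; split_ifs with h <;> simp [hg, h]

lemma cutoff_eq_sum_trunc (hg : 0 ≤ g ω) (a : ℕ) :
    cutoff a g ω = ∑ k ∈ range a, trunc g (k + 1) ω := by
  induction a with
  | zero => simp [cutoff_apply, hg]
  | succ a ih =>
    rw [sum_range_succ, ← ih, cutoff_apply, cutoff_apply, trunc_apply]
    push_cast
    rw [add_sub_cancel_right]
    by_cases h : g ω < a
    · rw [if_pos h, if_pos (by linarith), if_neg (by intro h'; linarith [h'.1]), add_zero]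
    · rw [if_neg h, zero_add]
      simp [not_lt.1 h]

lemma sq_cutoff_le (hg : 0 ≤ g ω) (a : ℕ) :
    cutoff a g ω ^ 2 ≤ ∑ l ∈ range a, (2 * (l : ℝ) + 1) * tailIndicator l g ω := by
  induction a with
  | zero => simp [cutoff_apply, hg.not_gt]
  | succ a ih =>
    by_cases h : g ω < a
    · have e : cutoff (a + 1) g ω = cutoff a g ω := by
        rw [cutoff_apply, cutoff_apply, if_pos h, if_pos (by push_cast; linarith)]
      rw [e, sum_range_succ]
      have := mul_nonneg (by positivity : 0 ≤ 2 * (a : ℝ) + 1) (tailIndicator_nonneg a g ω)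
      linarith
    · have e : ∑ l ∈ range (a + 1), (2 * (l : ℝ) + 1) * tailIndicator l g ω
          = ((a + 1 : ℕ) : ℝ) ^ 2 := by
        have h1 : ∀ l ∈ range (a + 1), (2 * (l : ℝ) + 1) * tailIndicator l g ω
            = 2 * (l : ℝ) + 1 := by
          intro l hl
          have : (l : ℝ) ≤ a := by exact_mod_cast Nat.lt_succ_iff.1 (mem_range.1 hl)
          rw [tailIndicator_apply, if_pos (this.trans (not_lt.1 h)), mul_one]
        rw [sum_congr rfl h1]
        induction a + 1 with
        | zero => simp
        | succ n ihn => rw [sum_range_succ, ihn]; push_cast; ring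
      rw [e]
      exact pow_le_pow_left₀ (cutoff_nonneg hg _) (cutoff_le _) 2

lemma sum_tailIndicator_le_self (hg : 0 ≤ g ω) (L : ℕ) :
    ∑ l ∈ range L, tailIndicator (l + 1) g ω ≤ g ω := by
  induction L with
  | zero => simpa using hg
  | succ L ih =>
    by_cases h : ((L + 1 : ℕ) : ℝ) ≤ g ω
    · calc _ ≤ ∑ l ∈ range (L + 1), (1 : ℝ) := sum_le_sum fun l _ => tailIndicator_le_one _ _ _
        _ ≤ g ω := by simpa using h
    · rw [sum_range_succ, tailIndicator_apply (L + 1), if_neg h, add_zero]; exact ih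

lemma sum_tailIndicator_sub_le_cutoff (hg : 0 ≤ g ω) (L b : ℕ) :
    ∑ l ∈ range L, (tailIndicator (l + 1) g ω - tailIndicator b g ω) ≤ cutoff b g ω := by
  by_cases h : g ω < b
  · rw [cutoff_apply, if_pos h, tailIndicator_apply b, if_neg (not_le.2 h)]
    simpa using sum_tailIndicator_le_self hg L
  · rw [cutoff_apply, if_neg h]
    refine sum_nonpos fun l _ => ?_
    rw [tailIndicator_apply b, if_pos (not_lt.1 h)]
    linarith [tailIndicator_le_one (l + 1) g ω]

variable [MeasurableSpace Ω]

lemma measurable_trunc (hg : Measurable g) (k : ℕ) : Measurable (trunc g k) :=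
  hg.indicator ((measurableSet_le measurable_const hg).inter
    (measurableSet_lt hg measurable_const))

lemma measurable_cutoff (hg : Measurable g) (a : ℕ) : Measurable (cutoff a g) :=
  hg.indicator (measurableSet_lt hg measurable_const)

lemma measurable_tailIndicator (hg : Measurable g) (l : ℕ) : Measurable (tailIndicator l g) :=
  measurable_one.indicator (measurableSet_le measurable_const hg)

lemma integrable_tailIndicator {μ : Measure Ω} [IsFiniteMeasure μ] (hg : Measurable g) (l : ℕ) :
    Integrable (tailIndicator l g) μ :=
  Integrable.of_bound (measurable_tailIndicator hg l).aestronglyMeasurable 1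
    (ae_of_all _ fun ω => by
      rw [Real.norm_eq_abs, abs_of_nonneg (tailIndicator_nonneg l g ω)]
      exact tailIndicator_le_one l g ω)

lemma integral_tailIndicator {μ : Measure Ω} (hg : Measurable g) (l : ℕ) :
    ∫ ω, tailIndicator l g ω ∂μ = μ.real {ω | (l : ℝ) ≤ g ω} := by
  rw [tailIndicator, integral_indicator_one (measurableSet_le measurable_const hg)]

end Pointwise

lemma summable_sum_range_div_succ_sq {q : ℕ → ℝ} (hq0 : ∀ l, 0 ≤ q l) (hq : Summable q) :
    Summable fun j : ℕ => (∑ l ∈ range j, (2 * (l : ℝ) + 1) * q l) / ((j : ℝ) + 1) ^ 2 := by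
  refine summable_of_sum_range_le (c := 4 * ∑' l, q l) (fun j => div_nonneg
    (sum_nonneg fun l _ => mul_nonneg (by positivity) (hq0 l)) (sq_nonneg _)) fun N => ?_
  calc ∑ j ∈ range N, (∑ l ∈ range j, (2 * (l : ℝ) + 1) * q l) / ((j : ℝ) + 1) ^ 2
      = ∑ j ∈ range N, ∑ l ∈ range j, (2 * (l : ℝ) + 1) * q l * (1 / ((j : ℝ) + 1) ^ 2) := by
        refine sum_congr rfl fun j _ => ?_
        rw [sum_div]
        exact sum_congr rfl fun l _ => by ring
    _ = ∑ l ∈ range N, ∑ j ∈ Ioo l N, (2 * (l : ℝ) + 1) * q l * (1 / ((j : ℝ) + 1) ^ 2) := by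
        refine sum_comm' fun j l => ?_
        simp only [mem_range, mem_Ioo]; omega
    _ ≤ ∑ l ∈ range N, 4 * q l := by
        refine sum_le_sum fun l _ => ?_
        rw [← mul_sum]
        have h1 : ∑ j ∈ Ioo l N, 1 / ((j : ℝ) + 1) ^ 2 ≤ 2 / ((l : ℝ) + 1) := by
          refine le_trans (sum_le_sum fun j hj => ?_) (sum_Ioo_inv_sq_le l N)
          have : (0 : ℝ) < j := by exact_mod_cast (Nat.zero_le l).trans_lt (mem_Ioo.1 hj).1
          rw [one_div]
          gcongr
          linarith
        calc _ ≤ (2 * (l : ℝ) + 1) * q l * (2 / ((l : ℝ) + 1)) :=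
              mul_le_mul_of_nonneg_left h1 (mul_nonneg (by positivity) (hq0 l))
          _ = q l * ((4 * (l : ℝ) + 2) / ((l : ℝ) + 1)) := by ring
          _ ≤ q l * 4 := by
              refine mul_le_mul_of_nonneg_left ?_ (hq0 l)
              rw [div_le_iff₀ (by positivity)]; linarith
          _ = 4 * q l := mul_comm _ _
    _ ≤ _ := by
        rw [← mul_sum]
        exact mul_le_mul_of_nonneg_left (hq.sum_le_tsum _ fun l _ => hq0 l) (by norm_num)

lemma ae_tendsto_cesaro_of_tail_le {Ω : Type*} [MeasurableSpace Ω] {μ : Measure Ω}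
    [IsFiniteMeasure μ] {g V : ℕ → Ω → ℝ} {w : Ω → ℝ} {M : ℝ} {q : ℕ → ℝ}
    (hg : ∀ j, Measurable (g j)) (hg0 : ∀ j ω, 0 ≤ g j ω)
    (hV : ∀ j, Measurable (V j)) (hVM : ∀ j, ∀ᵐ ω ∂μ, |V j ω| ≤ M)
    (hVw : ∀ᵐ ω ∂μ, Tendsto (fun j => V j ω) atTop (nhds (w ω)))
    (hq0 : ∀ l, 0 ≤ q l) (hq : Summable q)
    (htail : ∀ᶠ j : ℕ in atTop, ∀ l : ℕ,
      ∫ ω, tailIndicator l (g j) ω ∂μ ≤ q l + 1 / ((j : ℝ) + 1) ^ 2)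
    (hcross : ∀ᶠ j : ℕ in atTop, ∀ i < j,
      |∫ ω, (cutoff i (g i) ω - V i ω) * (cutoff j (g j) ω - V j ω) ∂μ|
        ≤ 1 / ((j : ℝ) + 1) ^ 2) :
    ∀ᵐ ω ∂μ, Tendsto (fun K : ℕ => (∑ j ∈ range K, g j ω) / K) atTop (nhds (w ω)) := by
  have hsq : Summable fun j : ℕ => (∫ ω, cutoff j (g j) ω ^ 2 ∂μ) / ((j : ℝ) + 1) ^ 2 := by
    refine Summable.of_norm_bounded_eventually_nat
      ((summable_sum_range_div_succ_sq hq0 hq).add summable_one_div_succ_sq) ?_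
    filter_upwards [htail] with j hj
    rw [Real.norm_eq_abs, abs_of_nonneg
      (div_nonneg (integral_nonneg fun ω => sq_nonneg _) (sq_nonneg _)), ← add_div]
    refine div_le_div_of_nonneg_right ?_ (sq_nonneg _)
    have hint : ∀ l ∈ range j,
        Integrable (fun ω => (2 * (l : ℝ) + 1) * tailIndicator l (g j) ω) μ :=
      fun l _ => (integrable_tailIndicator (hg j) l).const_mul _
    calc ∫ ω, cutoff j (g j) ω ^ 2 ∂μ
        ≤ ∫ ω, ∑ l ∈ range j, (2 * (l : ℝ) + 1) * tailIndicator l (g j) ω ∂μ :=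
          integral_mono_of_nonneg (ae_of_all _ fun ω => sq_nonneg _)
            (integrable_finsetSum _ hint) (ae_of_all _ fun ω => sq_cutoff_le (hg0 j ω) j)
      _ = ∑ l ∈ range j, (2 * (l : ℝ) + 1) * ∫ ω, tailIndicator l (g j) ω ∂μ := by
          rw [integral_finsetSum _ hint]
          exact sum_congr rfl fun l _ => integral_const_mul _ _
      _ ≤ ∑ l ∈ range j, (2 * (l : ℝ) + 1) * (q l + 1 / ((j : ℝ) + 1) ^ 2) := by
          gcongr with l _
          exact hj l
      _ = ∑ l ∈ range j, (2 * (l : ℝ) + 1) * q l + (j : ℝ) ^ 2 * (1 / ((j : ℝ) + 1) ^ 2) := by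
          have : ∑ l ∈ range j, (2 * (l : ℝ) + 1) = (j : ℝ) ^ 2 := by
            clear hj hint
            induction j with
            | zero => simp
            | succ n ihn => rw [sum_range_succ, ihn]; push_cast; ring
          simp_rw [mul_add]
          rw [sum_add_distrib, ← sum_mul, this]
      _ ≤ _ := by
          have : (j : ℝ) ^ 2 * (1 / ((j : ℝ) + 1) ^ 2) ≤ 1 := by
            rw [mul_one_div, div_le_one (by positivity)]
            nlinarith [Nat.cast_nonneg (α := ℝ) j]
          linarith
  have hcut := ae_tendsto_cesaro_of_almost_orthogonal (u := fun j => cutoff j (g j))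
    (fun j => measurable_cutoff (hg j) j) (fun j ω => cutoff_nonneg (hg0 j ω) j)
    (fun j => ⟨j, fun ω => cutoff_le j⟩) hV hVM hVw hsq hcross
  have hBC : ∑' j : ℕ, μ {ω | (j : ℝ) ≤ g j ω} ≠ ⊤ := by
    have hs : Summable fun j : ℕ => μ.real {ω | (j : ℝ) ≤ g j ω} := by
      refine Summable.of_norm_bounded_eventually_nat (hq.add summable_one_div_succ_sq) ?_
      filter_upwards [htail] with j hj
      rw [Real.norm_eq_abs, abs_of_nonneg measureReal_nonneg, ← integral_tailIndicator (hg j)]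
      exact hj j
    have := hs.tsum_ofReal_ne_top
    simpa only [ofReal_measureReal (measure_ne_top μ _)] using this
  filter_upwards [hcut, ae_eventually_notMem hBC] with ω h1 h2
  have h3 : Tendsto (fun j => g j ω - cutoff j (g j) ω) atTop (nhds 0) := by
    refine tendsto_const_nhds.congr' ?_
    filter_upwards [h2] with j hj
    have : g j ω < j := not_le.1 hj
    rw [cutoff_apply, if_pos this, sub_self]
  have h4 := h1.add (tendsto_sum_range_div h3)
  rw [add_zero] at h4
  refine h4.congr fun K => ?_
  rw [← add_div, ← sum_add_distrib]
  simp

section UltraWeakLimit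

variable {Ω : Type*} [MeasurableSpace Ω] {P : Measure Ω}

lemma integrable_of_nonneg_of_le [IsFiniteMeasure P] {g : Ω → ℝ} {b : ℝ} (hg : Measurable g)
    (h0 : ∀ ω, 0 ≤ g ω) (hb : ∀ ω, g ω ≤ b) : Integrable g P :=
  Integrable.of_bound hg.aestronglyMeasurable b
    (ae_of_all _ fun ω => by rw [Real.norm_eq_abs, abs_of_nonneg (h0 ω)]; exact hb ω)

lemma IsUltraWeakLimit.sum_range {g : ℕ → ℕ → Ω → ℝ} {W : ℕ → Ω → ℝ}
    (hg : ∀ k n, Integrable (g k n) P) (hW : ∀ k, Integrable (W k) P)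
    (h : ∀ k, IsUltraWeakLimit P (g k) (W k)) (a : ℕ) :
    IsUltraWeakLimit P (fun n ω => ∑ k ∈ range a, g k n ω) (fun ω => ∑ k ∈ range a, W k ω) := by
  rintro y hy ⟨c, hc⟩
  have hi : ∀ {k : Ω → ℝ}, Integrable k P → Integrable (fun ω => y ω * k ω) P := fun hk =>
    hk.bdd_mul hy.aestronglyMeasurable (ae_of_all _ hc)
  simp_rw [mul_sum]
  rw [integral_finsetSum _ fun k _ => hi (hW k)]
  simp_rw [fun n => integral_finsetSum (μ := P) (range a) fun k _ => hi (hg k n)]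
  exact tendsto_finsetSum _ fun k _ => h k y hy ⟨c, hc⟩

lemma IsUltraWeakLimit.tendsto_setIntegral {g : ℕ → Ω → ℝ} {W : Ω → ℝ}
    (h : IsUltraWeakLimit P g W) {s : Set Ω} (hs : MeasurableSet s) {y : Ω → ℝ}
    (hy : Measurable y) {c : ℝ} (hc : ∀ ω, |y ω| ≤ c) :
    Tendsto (fun n => ∫ ω in s, y ω * g n ω ∂P) (hyperfilter ℕ)
      (nhds (∫ ω in s, y ω * W ω ∂P)) := by
  have e : ∀ k : Ω → ℝ, ∫ ω, s.indicator y ω * k ω ∂P = ∫ ω in s, y ω * k ω ∂P := by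
    intro k
    rw [← integral_indicator hs]
    congr 1; ext ω; by_cases hω : ω ∈ s <;> simp [hω]
  have := h (s.indicator y) (hy.indicator hs) ⟨c, fun ω => by
    by_cases hω : ω ∈ s
    · simpa [hω] using hc ω
    · simpa [hω] using (abs_nonneg _).trans (hc ω)⟩
  simpa only [e] using this

lemma IsUltraWeakLimit.eventually_abs_setIntegral_le {g : ℕ → Ω → ℝ} {W : Ω → ℝ}
    (h : IsUltraWeakLimit P g W) (hg : ∀ n, Integrable (g n) P) (hW : Integrable W P)
    {s : Set Ω} (hs : MeasurableSet s) {y : Ω → ℝ}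
    (hy : Measurable y) {c : ℝ} (hc : ∀ ω, |y ω| ≤ c) {δ : ℝ} (hδ : 0 < δ) :
    ∀ᶠ n in (hyperfilter ℕ : Filter ℕ), |∫ ω in s, y ω * (g n ω - W ω) ∂P| ≤ δ := by
  have hi : ∀ {k : Ω → ℝ}, Integrable k P → IntegrableOn (fun ω => y ω * k ω) s P := fun hk =>
    (hk.bdd_mul hy.aestronglyMeasurable (ae_of_all _ hc)).integrableOn
  have h1 := (h.tendsto_setIntegral hs hy hc).sub_const (∫ ω in s, y ω * W ω ∂P)
  rw [sub_self] at h1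
  have h2 := h1.abs
  rw [abs_zero] at h2
  filter_upwards [h2.eventually_le_const hδ] with n hn
  simp_rw [mul_sub]
  rw [integral_sub (hi (hg n)) (hi hW)]
  exact hn

end UltraWeakLimit

lemma abs_sub_le_add_of_nonneg {x y a b : ℝ} (hx : 0 ≤ x) (hxa : x ≤ a) (hy : 0 ≤ y)
    (hyb : y ≤ b) : |x - y| ≤ a + b :=
  abs_le.2 ⟨by linarith, by linarith⟩

lemma ae_tendsto_cesaro_of_bounded {Ω : Type*} [MeasurableSpace Ω] {P : Measure Ω}
    [IsFiniteMeasure P] {g : ℕ → Ω → ℝ} {W : Ω → ℝ} {b : ℝ}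
    (hg : ∀ j, Measurable (g j)) (hg0 : ∀ j ω, 0 ≤ g j ω) (hgb : ∀ j ω, g j ω ≤ b)
    (hW : Measurable W) (hW0 : ∀ ω, 0 ≤ W ω) (hWb : ∀ ω, W ω ≤ b)
    (hcross : ∀ᶠ j : ℕ in atTop, ∀ i < j,
      |∫ ω, (g i ω - W ω) * (g j ω - W ω) ∂P| ≤ 1 / ((j : ℝ) + 1) ^ 2) :
    ∀ᵐ ω ∂P, Tendsto (fun K : ℕ => (∑ j ∈ range K, g j ω) / K) atTop (nhds (W ω)) := by
  refine ae_tendsto_cesaro_of_almost_orthogonal (v := fun _ => W) (M := b) hg hg0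
    (fun j => ⟨b, hgb j⟩) (fun _ => hW)
    (fun _ => ae_of_all _ fun ω => by rw [abs_of_nonneg (hW0 ω)]; exact hWb ω)
    (ae_of_all _ fun ω => tendsto_const_nhds) ?_ hcross
  refine Summable.of_nonneg_of_le (fun j => div_nonneg (integral_nonneg fun ω => sq_nonneg _)
    (sq_nonneg _)) (fun j => ?_) (summable_one_div_succ_sq.mul_left (b ^ 2 * P.real Set.univ))
  rw [mul_one_div]
  refine div_le_div_of_nonneg_right ?_ (sq_nonneg _)
  calc ∫ ω, g j ω ^ 2 ∂P ≤ ∫ _, b ^ 2 ∂P :=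
        integral_mono_of_nonneg (ae_of_all _ fun ω => sq_nonneg _) (integrable_const _)
          (ae_of_all _ fun ω => pow_le_pow_left₀ (hg0 j ω) (hgb j ω) 2)
    _ = b ^ 2 * P.real Set.univ := by rw [integral_const, smul_eq_mul, mul_comm]

/-- If the weak limits `V a` of the cutoffs have integrals at most `M` over a set `C`, and those of
the weak limits `G b` of the tail indicators tend to `0`, then `∑ l, ∫_C G l` converges. -/
lemma summable_setIntegral_of_isUltraWeakLimit {Ω : Type*} [MeasurableSpace Ω] {P : Measure Ω}
    [IsFiniteMeasure P] {f : ℕ → Ω → ℝ} (hf : ∀ n, Measurable (f n)) (hf0 : ∀ n ω, 0 ≤ f n ω)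
    {V G : ℕ → Ω → ℝ} (hG0 : ∀ l ω, 0 ≤ G l ω)
    (hV : ∀ a, IsUltraWeakLimit P (fun n => cutoff a (f n)) (V a))
    (hG : ∀ l, IsUltraWeakLimit P (fun n => tailIndicator l (f n)) (G l))
    {C : Set Ω} (hC : MeasurableSet C) {M : ℝ} (hVM : ∀ a, ∫ ω in C, V a ω ∂P ≤ M)
    (hGM : Tendsto (fun b => ∫ ω in C, G b ω ∂P) atTop (nhds 0)) :
    Summable fun l => ∫ ω in C, G l ω ∂P := by
  refine (summable_nat_add_iff 1).1 ?_
  refine summable_of_sum_range_le (c := M) (fun l => integral_nonneg fun ω => hG0 _ ω)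
    fun L => ?_
  have hlim : ∀ {g : ℕ → Ω → ℝ} {W : Ω → ℝ}, IsUltraWeakLimit P g W →
      Tendsto (fun n => ∫ ω in C, g n ω ∂P) (hyperfilter ℕ) (nhds (∫ ω in C, W ω ∂P)) := by
    intro g W h
    simpa using h.tendsto_setIntegral hC measurable_const (y := fun _ => 1) (c := 1) (by simp)
  have hb : ∀ b : ℕ, ∑ l ∈ range L, (∫ ω in C, G (l + 1) ω ∂P - ∫ ω in C, G b ω ∂P) ≤ M := by
    intro b
    refine le_trans ?_ (hVM b)
    refine le_of_tendsto_of_tendsto' (tendsto_finsetSum _ fun l _ =>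
      (hlim (hG (l + 1))).sub (hlim (hG b))) (hlim (hV b)) fun n => ?_
    have hti : ∀ l, Integrable (tailIndicator l (f n)) (P.restrict C) := fun l =>
      integrable_tailIndicator (hf n) l
    have hsub : ∀ l ∈ range L, Integrable
        (fun ω => tailIndicator (l + 1) (f n) ω - tailIndicator b (f n) ω) (P.restrict C) :=
      fun l _ => (hti (l + 1)).sub (hti b)
    simp_rw [← fun l => integral_sub (hti l) (hti b)]
    rw [← integral_finsetSum _ hsub]
    exact integral_mono (integrable_finsetSum _ hsub)
      (integrable_of_nonneg_of_le (measurable_cutoff (hf n) b)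
        (fun ω => cutoff_nonneg (hf0 n ω) b) fun ω => cutoff_le b)
      fun ω => sum_tailIndicator_sub_le_cutoff (hf0 n ω) L b
  have ht : Tendsto (fun b : ℕ => ∑ l ∈ range L,
      (∫ ω in C, G (l + 1) ω ∂P - ∫ ω in C, G b ω ∂P)) atTop
      (nhds (∑ l ∈ range L, (∫ ω in C, G (l + 1) ω ∂P - 0))) :=
    tendsto_finsetSum _ fun l _ => tendsto_const_nhds.sub hGM
  simp only [sub_zero] at ht
  exact le_of_tendsto' ht hb

lemma eventually_forall_setIntegral_tailIndicator_le {Ω : Type*} [MeasurableSpace Ω]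
    {P : Measure Ω} [IsFiniteMeasure P] {f : ℕ → Ω → ℝ} (hf : ∀ n, Measurable (f n))
    {G : ℕ → Ω → ℝ} (hG0 : ∀ l ω, 0 ≤ G l ω)
    (hG : ∀ l, IsUltraWeakLimit P (fun n => tailIndicator l (f n)) (G l))
    {C : Set Ω} (hC : MeasurableSet C)
    (hGM : Tendsto (fun b => ∫ ω in C, G b ω ∂P) atTop (nhds 0)) {δ : ℝ} (hδ : 0 < δ) :
    ∀ᶠ n in (hyperfilter ℕ : Filter ℕ), ∀ l,
      ∫ ω in C, tailIndicator l (f n) ω ∂P ≤ ∫ ω in C, G l ω ∂P + δ := by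
  obtain ⟨k, hk⟩ := (hGM.eventually_le_const (half_pos hδ)).exists
  have hlim : ∀ l, Tendsto (fun n => ∫ ω in C, tailIndicator l (f n) ω ∂P) (hyperfilter ℕ)
      (nhds (∫ ω in C, G l ω ∂P)) := fun l => by
    simpa using (hG l).tendsto_setIntegral hC measurable_const (y := fun _ => 1) (c := 1)
      (by simp)
  have h1 : ∀ᶠ n in (hyperfilter ℕ : Filter ℕ), ∀ l ∈ range (k + 1),
      ∫ ω in C, tailIndicator l (f n) ω ∂P ≤ ∫ ω in C, G l ω ∂P + δ / 2 :=
    (eventually_all_finset _).2 fun l _ =>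
      (hlim l).eventually_le_const (lt_add_of_pos_right _ (half_pos hδ))
  filter_upwards [h1] with n hn l
  rcases le_or_gt l k with hl | hl
  · have := hn l (mem_range.2 (Nat.lt_succ_iff.2 hl))
    linarith
  · have h2 := hn k (self_mem_range_succ k)
    have h3 : ∫ ω in C, tailIndicator l (f n) ω ∂P ≤ ∫ ω in C, tailIndicator k (f n) ω ∂P :=
      integral_mono (integrable_tailIndicator (hf n) l) (integrable_tailIndicator (hf n) k)
        (tailIndicator_anti hl.le (f n))
    have h4 : 0 ≤ ∫ ω in C, G l ω ∂P := integral_nonneg fun ω => hG0 l ω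
    linarith

lemma tendsto_ofReal_top_of_forall_exists {r : ℕ → ℝ}
    (h : ∀ M : ℕ, ∃ (x : ℝ) (s : ℕ → ℝ), (M : ℝ) < x ∧ Tendsto s atTop (nhds x) ∧
      ∀ K, s K ≤ r K) :
    Tendsto (fun K => ENNReal.ofReal (r K)) atTop (nhds ⊤) := by
  refine ENNReal.tendsto_ofReal_nhds_top.2 (tendsto_atTop.2 fun R => ?_)
  obtain ⟨M, hM⟩ := exists_nat_ge R
  obtain ⟨x, s, hx, hs, hle⟩ := h M
  filter_upwards [hs.eventually_const_lt hx] with K hK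
  exact hM.trans (hK.le.trans (hle K))

open Classical in
/-- For any sequence of nonnegative measurable functions there exist a subsequence,
limits `f^(k)` of the truncations in the hereditary Cesàro sense, and a measurable set
`A ⊇ {f = ∞}` (where `f = ∑_k f^(k)`), such that the subsequence converges hereditarily
in Cesàro mean, `P`-a.e., to the function equal to `∞` on `A` and to `f` off `A`. -/
theorem hereditary_cesaro_with_inflation {Ω : Type*} [MeasurableSpace Ω] (P : Measure Ω)
    [IsProbabilityMeasure P] (f : ℕ → Ω → ℝ)
    (hmeas : ∀ n, Measurable (f n)) (hpos : ∀ n ω, 0 ≤ f n ω) :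
    ∃ n : ℕ → ℕ, StrictMono n ∧
      ∃ F : ℕ → Ω → ℝ,
        (∀ k, Measurable (F k)) ∧ (∀ k ω, 0 ≤ F k ω) ∧
        (∀ k : ℕ, 1 ≤ k → ∀ φ : ℕ → ℕ, StrictMono φ →
          ∀ᵐ ω ∂P, Tendsto
            (fun J : ℕ => (∑ j ∈ Finset.range J, trunc (f (n (φ j))) k ω) / J)
            atTop (nhds (F k ω))) ∧
        ∃ A : Set Ω, MeasurableSet A ∧
          {ω | (∑' k : ℕ, ENNReal.ofReal (F (k + 1) ω)) = ⊤} ⊆ A ∧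
          ∀ φ : ℕ → ℕ, StrictMono φ →
            ∀ᵐ ω ∂P, Tendsto
              (fun J : ℕ =>
                ENNReal.ofReal ((∑ j ∈ Finset.range J, f (n (φ j)) ω) / J))
              atTop
              (nhds (if ω ∈ A then ⊤ else ∑' k : ℕ, ENNReal.ofReal (F (k + 1) ω))) := by
  have htm : ∀ k n, Measurable (trunc (f n) k) := fun k n => measurable_trunc (hmeas n) k
  choose F hFm hF0 hFb hF using fun k : ℕ => exists_isUltraWeakLimit P (fun n => trunc (f n) k)
    (htm k) (fun n ω => trunc_nonneg (hpos n ω) k) (fun n ω => trunc_le k) k.cast_nonneg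
  choose G hGm hG0 hGb hG using fun l : ℕ => exists_isUltraWeakLimit P
    (fun n => tailIndicator l (f n)) (fun n => measurable_tailIndicator (hmeas n) l)
    (fun n ω => tailIndicator_nonneg l (f n) ω) (fun n ω => tailIndicator_le_one l (f n) ω)
    zero_le_one
  have hFi : ∀ k, Integrable (F k) P := fun k =>
    integrable_of_nonneg_of_le (hFm k) (hF0 k) (hFb k)
  have hti : ∀ k n, Integrable (trunc (f n) k) P := fun k n =>
    integrable_of_nonneg_of_le (htm k n) (fun ω => trunc_nonneg (hpos n ω) k) fun ω => trunc_le k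
  have hGi : ∀ k, Integrable (G k) P := fun k =>
    integrable_of_nonneg_of_le (hGm k) (hG0 k) (hGb k)
  set V : ℕ → Ω → ℝ := fun a ω => ∑ k ∈ range a, F (k + 1) ω with hVdef
  have hVm : ∀ a, Measurable (V a) := fun a =>
    Finset.measurable_fun_sum _ fun k _ => hFm (k + 1)
  have hV0 : ∀ a ω, 0 ≤ V a ω := fun a ω => sum_nonneg fun k _ => hF0 _ ω
  have hVb : ∀ a ω, V a ω ≤ ∑ k ∈ range a, ((k + 1 : ℕ) : ℝ) := fun a ω =>
    sum_le_sum fun k _ => hFb _ ω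
  have hVi : ∀ a, Integrable (V a) P := fun a =>
    integrable_of_nonneg_of_le (hVm a) (hV0 a) (hVb a)
  have hV : ∀ a, IsUltraWeakLimit P (fun n => cutoff a (f n)) (V a) := fun a => by
    have e : (fun n => cutoff a (f n)) = fun n ω => ∑ k ∈ range a, trunc (f n) (k + 1) ω := by
      ext n ω; exact cutoff_eq_sum_trunc (hpos n ω) a
    rw [e]
    exact IsUltraWeakLimit.sum_range (g := fun k n => trunc (f n) (k + 1))
      (fun k n => hti (k + 1) n) (fun k => hFi (k + 1)) (fun k => hF (k + 1)) a
  set S : Ω → ℝ≥0∞ := fun ω => ∑' k : ℕ, ENNReal.ofReal (F (k + 1) ω) with hS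
  have hSm : Measurable S := Measurable.tsum fun k => (hFm (k + 1)).ennreal_ofReal
  have hVS : ∀ a ω, ENNReal.ofReal (V a ω) = ∑ k ∈ range a, ENNReal.ofReal (F (k + 1) ω) :=
    fun a ω => ENNReal.ofReal_sum_of_nonneg fun k _ => hF0 _ ω
  set C : ℕ → Set Ω := fun M => {ω | S ω ≤ M} ∩ ⋂ l : ℕ, {ω | l * G l ω ≤ M} with hC
  have hCm : ∀ M, MeasurableSet (C M) := fun M =>
    (measurableSet_le hSm measurable_const).inter (MeasurableSet.iInter fun l =>
      measurableSet_le ((hGm l).const_mul _) measurable_const)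
  have hVC : ∀ M a, ∀ ω ∈ C M, V a ω ≤ M := fun M a ω hω => by
    have : ENNReal.ofReal (V a ω) ≤ M := by
      rw [hVS]; exact (ENNReal.sum_le_tsum _).trans hω.1
    rwa [← ENNReal.ofReal_natCast, ENNReal.ofReal_le_ofReal_iff M.cast_nonneg] at this
  have hVint : ∀ M a, ∫ ω in C M, V a ω ∂P ≤ M := fun M a => by
    calc ∫ ω in C M, V a ω ∂P ≤ ∫ _ in C M, (M : ℝ) ∂P :=
          setIntegral_mono_on (hVi a).integrableOn (integrable_const _) (hCm M) (hVC M a)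
      _ = P.real (C M) * M := by simp
      _ ≤ 1 * M := mul_le_mul_of_nonneg_right measureReal_le_one M.cast_nonneg
      _ = M := one_mul _
  have hGlim : ∀ M, Tendsto (fun b => ∫ ω in C M, G b ω ∂P) atTop (nhds 0) := fun M => by
    refine tendsto_of_tendsto_of_tendsto_of_le_of_le' tendsto_const_nhds
      (tendsto_const_div_atTop_nhds_zero_nat (M : ℝ))
      (Eventually.of_forall fun b => integral_nonneg fun ω => hG0 b ω) ?_
    filter_upwards [eventually_gt_atTop 0] with b hb
    have hb' : (0 : ℝ) < b := by exact_mod_cast hb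
    calc ∫ ω in C M, G b ω ∂P ≤ ∫ _ in C M, (M / b : ℝ) ∂P :=
          setIntegral_mono_on (hGi b).integrableOn (integrable_const _) (hCm M) fun ω hω => by
            rw [le_div_iff₀' hb']; exact Set.mem_iInter.1 hω.2 b
      _ = P.real (C M) * (M / b) := by simp
      _ ≤ 1 * (M / b) := mul_le_mul_of_nonneg_right measureReal_le_one (by positivity)
      _ = M / b := one_mul _
  obtain ⟨n, hn, hQ⟩ := exists_strictMono_of_eventually_hyperfilter
    (Q := fun m N n =>
      (∀ k ∈ range (m + 1), |∫ ω, (trunc (f N) k ω - F k ω) * (trunc (f n) k ω - F k ω) ∂P|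
        ≤ 1 / ((m : ℝ) + 1) ^ 2) ∧
      (∀ l ∈ range (m + 1), |∫ ω, (tailIndicator l (f N) ω - G l ω) *
        (tailIndicator l (f n) ω - G l ω) ∂P| ≤ 1 / ((m : ℝ) + 1) ^ 2) ∧
      (∀ M ∈ range (m + 1), ∀ a ∈ range (m + 1), ∀ b ∈ range (m + 1),
        |∫ ω in C M, (cutoff a (f N) ω - V a ω) * (cutoff b (f n) ω - V b ω) ∂P|
          ≤ 1 / ((m : ℝ) + 1) ^ 2) ∧
      ∀ M ∈ range (m + 1), ∀ l : ℕ, ∫ ω in C M, tailIndicator l (f n) ω ∂P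
        ≤ ∫ ω in C M, G l ω ∂P + 1 / ((m : ℝ) + 1) ^ 2) (fun m N => by
    have hδ : 0 < 1 / ((m : ℝ) + 1) ^ 2 := by positivity
    refine Filter.Eventually.and ?_ (Filter.Eventually.and ?_ (Filter.Eventually.and ?_ ?_))
    · refine (eventually_all_finset _).2 fun k _ => ?_
      simpa only [Measure.restrict_univ, Pi.sub_apply] using
        (hF k).eventually_abs_setIntegral_le (hti k) (hFi k) MeasurableSet.univ ((htm k N).sub (hFm k)) (fun ω => abs_sub_le_add_of_nonneg
          (trunc_nonneg (hpos N ω) k) (trunc_le k) (hF0 k ω) (hFb k ω)) hδ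
    · refine (eventually_all_finset _).2 fun l _ => ?_
      simpa only [Measure.restrict_univ, Pi.sub_apply] using (hG l).eventually_abs_setIntegral_le
        (fun n => integrable_tailIndicator (hmeas n) l)
        (hGi l) MeasurableSet.univ ((measurable_tailIndicator (hmeas N) l).sub (hGm l))
        (fun ω => abs_sub_le_add_of_nonneg (tailIndicator_nonneg l (f N) ω)
          (tailIndicator_le_one l (f N) ω) (hG0 l ω) (hGb l ω)) hδ
    · refine (eventually_all_finset _).2 fun M _ => (eventually_all_finset _).2 fun a _ =>
        (eventually_all_finset _).2 fun b _ => ?_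
      exact (hV b).eventually_abs_setIntegral_le
        (fun n => integrable_of_nonneg_of_le (measurable_cutoff (hmeas n) b)
          (fun ω => cutoff_nonneg (hpos n ω) b) fun ω => cutoff_le b)
        (hVi b) (hCm M) ((measurable_cutoff (hmeas N) a).sub (hVm a))
        (fun ω => abs_sub_le_add_of_nonneg (cutoff_nonneg (hpos N ω) a)
          (cutoff_le a) (hV0 a ω) (hVb a ω)) hδ
    · exact (eventually_all_finset _).2 fun M _ =>
        eventually_forall_setIntegral_tailIndicator_le hmeas hG0 hG (hCm M) (hGlim M) hδ)
  have hδle : ∀ {φ : ℕ → ℕ}, StrictMono φ → ∀ j : ℕ,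
      1 / ((φ j : ℝ) + 1) ^ 2 ≤ 1 / ((j : ℝ) + 1) ^ 2 := fun {φ} hφ j => by
    have : (j : ℝ) ≤ φ j := by exact_mod_cast hφ.le_apply
    gcongr
  have hmem : ∀ {φ : ℕ → ℕ}, StrictMono φ → ∀ {i j : ℕ}, i ≤ j → i ∈ range (φ j + 1) :=
    fun hφ i j hij => mem_range.2 (Nat.lt_succ_of_le (hij.trans hφ.le_apply))
  have htrunc : ∀ k : ℕ, ∀ φ : ℕ → ℕ, StrictMono φ → ∀ᵐ ω ∂P, Tendsto
      (fun J : ℕ => (∑ j ∈ range J, trunc (f (n (φ j))) k ω) / J) atTop (nhds (F k ω)) := by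
    intro k φ hφ
    refine ae_tendsto_cesaro_of_bounded (fun j => htm k _)
      (fun j ω => trunc_nonneg (hpos _ ω) k) (fun j ω => trunc_le k) (hFm k) (hF0 k) (hFb k) ?_
    filter_upwards [eventually_ge_atTop k] with j hj i hij
    exact ((hQ _ _ (hφ hij)).1 k (hmem hφ hj)).trans (hδle hφ j)
  have htail : ∀ l : ℕ, ∀ φ : ℕ → ℕ, StrictMono φ → ∀ᵐ ω ∂P, Tendsto
      (fun J : ℕ => (∑ j ∈ range J, tailIndicator l (f (n (φ j))) ω) / J) atTop
      (nhds (G l ω)) := by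
    intro l φ hφ
    refine ae_tendsto_cesaro_of_bounded (fun j => measurable_tailIndicator (hmeas _) l)
      (fun j ω => tailIndicator_nonneg l _ ω) (fun j ω => tailIndicator_le_one l _ ω)
      (hGm l) (hG0 l) (hGb l) ?_
    filter_upwards [eventually_ge_atTop l] with j hj i hij
    exact ((hQ _ _ (hφ hij)).2.1 l (hmem hφ hj)).trans (hδle hφ j)
  have hfin : ∀ M : ℕ, ∀ φ : ℕ → ℕ, StrictMono φ → ∀ᵐ ω ∂P, ω ∈ C M → Tendsto
      (fun J : ℕ => (∑ j ∈ range J, f (n (φ j)) ω) / J) atTop (nhds (S ω).toReal) := by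
    intro M φ hφ
    refine (ae_restrict_iff' (hCm M)).1 ?_
    refine ae_tendsto_cesaro_of_tail_le (V := V) (M := M) (q := fun l => ∫ ω in C M, G l ω ∂P)
      (fun j => hmeas _) (fun j ω => hpos _ ω) hVm (fun a => ?_) ?_
      (fun l => integral_nonneg fun ω => hG0 l ω)
      (summable_setIntegral_of_isUltraWeakLimit hmeas hpos hG0 hV hG (hCm M) (hVint M)
        (hGlim M)) ?_ ?_
    · filter_upwards [ae_restrict_mem (hCm M)] with ω hω
      rw [abs_of_nonneg (hV0 a ω)]; exact hVC M a ω hω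
    · filter_upwards [ae_restrict_mem (hCm M)] with ω hω
      have hfinite : S ω ≠ ⊤ := (hω.1.trans_lt (ENNReal.natCast_lt_top M)).ne
      have h1 := (ENNReal.tendsto_toReal hfinite).comp
        (ENNReal.tendsto_nat_tsum fun k => ENNReal.ofReal (F (k + 1) ω))
      refine h1.congr fun a => ?_
      rw [Function.comp_apply, ← hVS, ENNReal.toReal_ofReal (hV0 a ω)]
    · filter_upwards [eventually_ge_atTop M, eventually_gt_atTop 0] with j hj hj0 l
      exact ((hQ _ _ (hφ hj0)).2.2.2 M (hmem hφ hj) l).trans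
        (add_le_add_right (hδle hφ j) _)
    · filter_upwards [eventually_ge_atTop M] with j hj i hij
      exact ((hQ _ _ (hφ hij)).2.2.1 M (hmem hφ hj) i (hmem hφ hij.le) j
        (hmem hφ le_rfl)).trans (hδle hφ j)
  refine ⟨n, hn, F, hFm, hF0, fun k _ => htrunc k, (⋃ M, C M)ᶜ,
    (MeasurableSet.iUnion hCm).compl, fun ω hω hmem' => ?_, fun φ hφ => ?_⟩
  · obtain ⟨M, hM⟩ := Set.mem_iUnion.1 hmem'
    exact (hM.1.trans_lt (ENNReal.natCast_lt_top M)).ne hω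
  filter_upwards [ae_all_iff.2 fun M => hfin M φ hφ, ae_all_iff.2 fun k => htrunc k φ hφ,
    ae_all_iff.2 fun l => htail l φ hφ] with ω h1 h2 h3
  split_ifs with hA
  · refine tendsto_ofReal_top_of_forall_exists fun M => ?_
    have hM : ω ∉ C M := fun h => hA (Set.mem_iUnion.2 ⟨M, h⟩)
    by_cases hSM : S ω ≤ M
    · obtain ⟨l, hl⟩ : ∃ l : ℕ, (M : ℝ) < l * G l ω := by
        by_contra! hcon
        exact hM ⟨hSM, Set.mem_iInter.2 hcon⟩
      refine ⟨_, _, hl, (h3 l).const_mul (l : ℝ), fun K => ?_⟩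
      rw [← mul_div_assoc, mul_sum]
      gcongr with j _
      exact mul_tailIndicator_le_self (hpos _ ω) l
    · obtain ⟨a, ha⟩ : ∃ a : ℕ, (M : ℝ) < V a ω := by
        by_contra! hcon
        refine hSM (ENNReal.tsum_le_of_sum_range_le fun a => ?_)
        rw [← hVS, ← ENNReal.ofReal_natCast]
        exact ENNReal.ofReal_le_ofReal (hcon a)
      refine ⟨_, _, ha, tendsto_finsetSum _ fun k _ => h2 (k + 1), fun K => ?_⟩
      rw [← sum_div, sum_comm]
      gcongr with j _
      rw [← cutoff_eq_sum_trunc (hpos _ ω)]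
      exact cutoff_le_self (hpos _ ω) a
  · obtain ⟨M, hM⟩ := Set.mem_iUnion.1 (not_not.1 hA)
    have hfinite : S ω ≠ ⊤ := (hM.1.trans_lt (ENNReal.natCast_lt_top M)).ne
    have := ENNReal.tendsto_ofReal (h1 M hM)
    rwa [ENNReal.ofReal_toReal hfinite] at this
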